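/- arXiv:1403.4120 — 2 statements merged into one kernel-verified Lean document; each statement's English description precedes it below -/
import Mathlib

section
/- Let (A, *, α) be a multiplicative Hom-Malcev algebra and define (x,y,z)_α := (1/3)(-J_α(x,y,z) + 3(x*y)*α(z)). Then (A, *, (,,)_α, α) is a Hom-Bol algebra. -/
def Jac {A : Type*} [AddCommGroup A] (m : A → A → A) (f : A → A) (x y z : A) : A :=
  m (m x y) (f z) + m (m y z) (f x) + m (m z x) (f y)

def hAssoc {A : Type*} [AddCommGroup A] (m : A → A → A) (f : A → A) (x y z : A) : A :=
  m (m x y) (f z) - m (f x) (m y z)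

def jord {A : Type*} [AddCommGroup A] (m : A → A → A) (x y : A) : A := m x y + m y x

def jAssoc {A : Type*} [AddCommGroup A] (m : A → A → A) (f : A → A) (x y z : A) : A :=
  jord m (jord m x y) (f z) - jord m (f x) (jord m y z)

section HomMalcev

variable {K A : Type*} [Field K] [AddCommGroup A] [Module K A]
  {mul : A →ₗ[K] A →ₗ[K] A} {α : A →ₗ[K] A}

local notation "J" => Jac (fun a b => mul a b) α

theorem Jac_cyclic (x y z : A) : J x y z = J y z x := by
  simp only [Jac]; abel

theorem Jac_swap (anticomm : ∀ x y : A, mul x y = - mul y x) (x y z : A) :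
    J x y z = - J y x z := by
  simp only [Jac]
  rw [anticomm x y, anticomm y z, anticomm z x]
  simp only [map_neg, LinearMap.neg_apply]
  abel

theorem Jac_neg_right (x y z : A) : J x y (-z) = - J x y z := by
  simp only [Jac, map_neg, LinearMap.neg_apply]
  abel

/-- The full linearization of the Hom-Malcev identity. -/
theorem malcev_linearized
    (malcev : ∀ x y z : A, J (α x) (α y) (mul x z) = mul (J x y z) (α (α x)))
    (x w y z : A) :
    J (α x) (α y) (mul w z) + J (α w) (α y) (mul x z)
      = mul (J x y z) (α (α w)) + mul (J w y z) (α (α x)) := by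
  have h := malcev (x + w) y z
  have hx := malcev x y z
  have hw := malcev w y z
  simp only [Jac, map_add, LinearMap.add_apply] at h hx hw ⊢
  linear_combination (norm := module) h - hx - hw

/-- The defect of `J x y` from being a derivation, in a Hom-Malcev algebra. -/
theorem Jac_mul_right [CharZero K] (anticomm : ∀ x y : A, mul x y = - mul y x)
    (mult : ∀ x y : A, α (mul x y) = mul (α x) (α y))
    (malcev : ∀ x y z : A, J (α x) (α y) (mul x z) = mul (J x y z) (α (α x)))
    (x y u v : A) :
    J (α x) (α y) (mul u v) + (2 : K) • J (α u) (α v) (mul x y)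
      = mul (J x y u) (α (α v)) + mul (α (α u)) (J x y v) := by
  have h₁ := malcev_linearized malcev x y u v
  have h₂ := malcev_linearized malcev u x v y
  have h₃ := malcev_linearized malcev u v x y
  have h₄ := malcev_linearized malcev v x y u
  have sort : ∀ a b c : A, mul (α c) (mul a b) = - mul (mul a b) (α c) :=
    fun a b c => anticomm _ _
  simp only [Jac, map_add, map_neg, LinearMap.add_apply, LinearMap.neg_apply, mult, sort,
    anticomm y x, anticomm u x, anticomm v x, anticomm u y, anticomm v y, anticomm v u,
    anticomm (α u) (α x), anticomm (α v) (α x),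
    anticomm (α v) (α y),
    anticomm (mul (α u) (α v)) (mul (α x) (α y)),
    anticomm (mul (α y) (α v)) (mul (α x) (α u)),
    anticomm (mul (α y) (α u)) (mul (α x) (α v))] at h₁ h₂ h₃ h₄ ⊢
  linear_combination (norm := module)
    (-1 / 2 : K) • h₁ + (3 / 2 : K) • h₂ + h₃ - (1 / 2 : K) • h₄

/-- The cyclic relation behind the derivation property of the ternary product of a Hom-Malcev
algebra. -/
theorem Jac_mul_cyclic (anticomm : ∀ x y : A, mul x y = - mul y x)
    (malcev : ∀ x y z : A, J (α x) (α y) (mul x z) = mul (J x y z) (α (α x)))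
    (u v w c : A) :
    (2 : K) • J (mul u v) (α w) (α c) - J (mul v w) (α u) (α c) - J (mul w u) (α v) (α c)
      = mul (J v w c) (α (α u)) + mul (J w u c) (α (α v))
        - (2 : K) • mul (J u v c) (α (α w)) := by
  have h₁ := malcev_linearized malcev w u c v
  have h₂ := malcev_linearized malcev w v c u
  rw [anticomm w v, Jac_neg_right, ← Jac_cyclic (mul u v), ← Jac_cyclic (mul v w),
    ← Jac_cyclic v w c, Jac_cyclic u c v, Jac_swap anticomm c v u, Jac_cyclic v c u,
    Jac_cyclic c u v] at h₁
  rw [anticomm v u, Jac_neg_right, ← Jac_cyclic (mul u v), ← Jac_cyclic (mul w u),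
    Jac_swap anticomm w c u, Jac_cyclic c w u, ← Jac_cyclic u v c] at h₂
  simp only [map_neg, LinearMap.neg_apply] at h₁ h₂
  linear_combination (norm := module) h₁ - h₂

end HomMalcev

theorem stmt8 {K A : Type*} [Field K] [CharZero K] [AddCommGroup A] [Module K A]
    (mul : A →ₗ[K] A →ₗ[K] A) (α : A →ₗ[K] A)
    (anticomm : ∀ x y : A, mul x y = - mul y x)
    (mult : ∀ x y : A, α (mul x y) = mul (α x) (α y))
    (malcev : ∀ x y z : A, Jac (fun a b => mul a b) α (α x) (α y) (mul x z)
        = mul (Jac (fun a b => mul a b) α x y z) (α (α x)))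
    (T : A → A → A → A)
    (hT : ∀ x y z : A, T x y z
        = (3 : K)⁻¹ • (- Jac (fun a b => mul a b) α x y z + 3 • mul (mul x y) (α z))) :
    (∀ x y : A, α (mul x y) = mul (α x) (α y))
    ∧ (∀ x y z : A, α (T x y z) = T (α x) (α y) (α z))
    ∧ (∀ x y : A, mul x y = - mul y x)
    ∧ (∀ x y z : A, T x y z = - T y x z)
    ∧ (∀ x y z : A, T x y z + T y z x + T z x y = 0)
    ∧ (∀ u v x y : A, T (α x) (α y) (mul u v)
        = mul (T x y u) (α (α v)) + mul (α (α u)) (T x y v)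
          + T (α u) (α v) (mul x y)
          - mul (mul (α u) (α v)) (mul (α x) (α y)))
    ∧ (∀ u v w x y : A, T (α (α x)) (α (α y)) (T u v w)
        = T (T x y u) (α (α v)) (α (α w))
          + T (α (α u)) (T x y v) (α (α w))
          + T (α (α u)) (α (α v)) (T x y w)) := by
  have hS (x y z : A) : T x y z = (3 : K)⁻¹ • ((2 : K) • mul (mul x y) (α z)
      - mul (mul y z) (α x) - mul (mul z x) (α y)) := by
    rw [hT, Jac]; module
  have hmap (x y z : A) : α (T x y z) = T (α x) (α y) (α z) := by
    simp only [hS, map_smul, map_sub, mult]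
  have hlin (a b p q r : A) : T a b ((3 : K)⁻¹ • ((2 : K) • p - q - r))
      = (3 : K)⁻¹ • ((2 : K) • T a b p - T a b q - T a b r) := by
    simp only [hS, map_smul, map_sub, LinearMap.smul_apply, LinearMap.sub_apply]
    module
  have hder (x y u v : A) : T (α x) (α y) (mul u v)
      = mul (T x y u) (α (α v)) + mul (α (α u)) (T x y v)
        - (3 : K)⁻¹ • Jac (fun a b => mul a b) α (α u) (α v) (mul x y) := by
    have h := Jac_mul_right anticomm mult malcev x y u v
    have e : Jac (fun a b => mul a b) α (α u) (α v) (mul x y)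
        = mul (mul (α u) (α v)) (mul (α x) (α y)) + mul (α (α u)) (mul (mul x y) (α v))
          + mul (mul (mul x y) (α u)) (α (α v)) := by
      rw [Jac, mult, anticomm (α v), anticomm (α (α u)), map_neg, LinearMap.neg_apply]
    simp only [hT, map_smul, map_add, map_neg, LinearMap.smul_apply, LinearMap.add_apply,
      LinearMap.neg_apply, mult, map_nsmul]
    rw [anticomm (mul (α u) (α v))] at e
    linear_combination (norm := module) (-1 / 3 : K) • h + e
  refine ⟨mult, hmap, anticomm, ?_, ?_, ?_, ?_⟩
  · intro x y z
    rw [hT, hT y, Jac_swap anticomm, anticomm x y]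
    simp only [map_neg, LinearMap.neg_apply]
    module
  · intro x y z
    simp only [hS]
    module
  · intro u v x y
    rw [hder, hT (α u), mult x y]
    module
  · intro u v w x y
    have hder₂ (p q r : A) : T (α (α x)) (α (α y)) (mul (mul p q) (α r))
        = mul (mul (T x y p) (α (α q))) (α (α (α r)))
          + mul (mul (α (α p)) (T x y q)) (α (α (α r)))
          - (3 : K)⁻¹ • mul (Jac (fun a b => mul a b) α (α p) (α q) (mul x y)) (α (α (α r)))
          + mul (mul (α (α p)) (α (α q))) (α (T x y r))
          - (3 : K)⁻¹ • Jac (fun a b => mul a b) α (mul (α p) (α q)) (α (α r))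
              (α (mul x y)) := by
      rw [hder, hder, mult p q, mult (α p), hmap, mult x y]
      simp only [map_add, map_sub, map_smul, LinearMap.add_apply, LinearMap.sub_apply,
        LinearMap.smul_apply]
    have h := Jac_mul_cyclic anticomm malcev (α u) (α v) (α w) (mul x y)
    rw [hS u v w, hlin, hder₂, hder₂, hder₂, hS (T x y u), hS _ (T x y v), hS _ _ (T x y w)]
    linear_combination (norm := module) (-1 / 9 : K) • h
end

section
/- Let (A, *, α) be a multiplicative right Hom-alternative algebra. Define [x,y] := x*y - y*x and (x,y,z) := [[x,y], α(z)] - 2·as(z,x,y). Then (A, [,], (,,), α) is a Hom-Bol algebra. -/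
/-- The Hom-commutator of a bilinear product. -/
def hComm {K A : Type*} [Field K] [AddCommGroup A] [Module K A]
    (mul : A →ₗ[K] A →ₗ[K] A) (x y : A) : A := mul x y - mul y x

/-- The ternary bracket attached to a bilinear product and a twisting map. -/
def hTriple {K A : Type*} [Field K] [AddCommGroup A] [Module K A]
    (mul : A →ₗ[K] A →ₗ[K] A) (α : A →ₗ[K] A) (x y z : A) : A :=
  hComm mul (hComm mul x y) (α z) - 2 • hAssoc (fun a b => mul a b) α z x y

/-- Linearization of right Hom-alternativity. -/
theorem right_alternative_linearized {K A : Type*} [Field K] [AddCommGroup A] [Module K A]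
    (mul : A →ₗ[K] A →ₗ[K] A) (α : A →ₗ[K] A)
    (altR : ∀ x y : A, hAssoc (fun a b => mul a b) α x y y = 0) (x y z : A) :
    mul (mul x y) (α z) - mul (α x) (mul y z) + (mul (mul x z) (α y) - mul (α x) (mul z y))
      = 0 := by
  have h₁ := altR x (y + z)
  have h₂ := altR x y
  have h₃ := altR x z
  simp only [hAssoc, map_add, LinearMap.add_apply] at h₁ h₂ h₃
  linear_combination (norm := module) h₁ - h₂ - h₃

/-- The ternary bracket is a Lie triple bracket of the Hom-Jordan product. -/
theorem hTriple_eq_jord {K A : Type*} [Field K] [AddCommGroup A] [Module K A]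
    (mul : A →ₗ[K] A →ₗ[K] A) (α : A →ₗ[K] A)
    (altR : ∀ x y : A, hAssoc (fun a b => mul a b) α x y y = 0) (x y z : A) :
    hTriple mul α x y z = jord (fun a b => mul a b) (jord (fun a b => mul a b) y z) (α x)
      - jord (fun a b => mul a b) (jord (fun a b => mul a b) x z) (α y) := by
  have h := right_alternative_linearized mul α altR
  simp only [hTriple, hComm, hAssoc, jord, map_add, map_sub, LinearMap.add_apply,
    LinearMap.sub_apply]
  linear_combination (norm := module) h x y z - h y x z - h z x y

/-- The operators `hTriple x y` are twisted derivations of the Hom-Jordan product. -/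
theorem hTriple_jord {K A : Type*} [Field K] [AddCommGroup A] [Module K A]
    (mul : A →ₗ[K] A →ₗ[K] A) (α : A →ₗ[K] A)
    (mult : ∀ x y : A, α (mul x y) = mul (α x) (α y))
    (altR : ∀ x y : A, hAssoc (fun a b => mul a b) α x y y = 0)
    (u v x y : A) :
    hTriple mul α (α x) (α y) (jord (fun a b => mul a b) u v)
      = jord (fun a b => mul a b) (hTriple mul α x y u) (α (α v))
        + jord (fun a b => mul a b) (α (α u)) (hTriple mul α x y v) := by
  have h := right_alternative_linearized mul α altR
  have hl (a b c d : A) := congrArg (mul · d) (h a b c)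
  have hr (a b c d : A) := congrArg (mul d) (h a b c)
  have hm₁ (a b c d : A) := h (mul a b) c d
  have hm₂ (a b c d : A) := h a (mul b c) d
  simp only [map_add, map_sub, map_zero, LinearMap.add_apply, LinearMap.sub_apply,
    LinearMap.zero_apply, mult] at hl hr hm₁ hm₂
  simp only [hTriple, hComm, hAssoc, jord, map_add, map_sub, map_nsmul, mult,
    LinearMap.add_apply, LinearMap.sub_apply, LinearMap.smul_apply]
  linear_combination (norm := module)
    - hm₁ u v (α x) (α y)
      + hm₁ u x (α v) (α y)
      - hm₁ u y (α v) (α x)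
      - hm₁ v u (α x) (α y)
      + hm₁ v x (α u) (α y)
      - hm₁ v y (α u) (α x)
      - hm₁ x y (α u) (α v)
      + hm₁ y x (α u) (α v)
      - hm₂ (α u) v x (α y)
      + hm₂ (α u) v y (α x)
      - hm₂ (α u) x v (α y)
      + hm₂ (α u) y v (α x)
      - hm₂ (α v) u x (α y)
      + hm₂ (α v) u y (α x)
      - hm₂ (α v) x u (α y)
      + hm₂ (α v) y u (α x)
      - hl u v x (α (α y))
      + hl u v y (α (α x))
      + hl u x y (α (α v))
      - hl v u x (α (α y))
      + hl v u y (α (α x))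
      + hl v x y (α (α u))
      + hr u x y (α (α v))
      + hr v x y (α (α u))
      - hr x u y (α (α v))
      - hr x v y (α (α u))
      + hr y u x (α (α v))
      + hr y v x (α (α u))

/-- The operators `hTriple x y` are twisted pseudo-derivations of the Hom-commutator. -/
theorem hTriple_hComm {K A : Type*} [Field K] [AddCommGroup A] [Module K A]
    (mul : A →ₗ[K] A →ₗ[K] A) (α : A →ₗ[K] A)
    (mult : ∀ x y : A, α (mul x y) = mul (α x) (α y))
    (altR : ∀ x y : A, hAssoc (fun a b => mul a b) α x y y = 0)
    (u v x y : A) :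
    hTriple mul α (α x) (α y) (hComm mul u v)
      = hComm mul (hTriple mul α x y u) (α (α v)) + hComm mul (α (α u)) (hTriple mul α x y v)
        + hTriple mul α (α u) (α v) (hComm mul x y)
        - hComm mul (hComm mul (α u) (α v)) (hComm mul (α x) (α y)) := by
  have h := right_alternative_linearized mul α altR
  have hl (a b c d : A) := congrArg (mul · d) (h a b c)
  have hr (a b c d : A) := congrArg (mul d) (h a b c)
  have hm₁ (a b c d : A) := h (mul a b) c d
  have hm₂ (a b c d : A) := h a (mul b c) d
  simp only [map_add, map_sub, map_zero, LinearMap.add_apply, LinearMap.sub_apply,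
    LinearMap.zero_apply, mult] at hl hr hm₁ hm₂
  simp only [hTriple, hComm, hAssoc, map_sub, map_nsmul, mult, LinearMap.sub_apply,
    LinearMap.smul_apply]
  linear_combination (norm := module)
    - hm₁ u v (α x) (α y)
      + hm₁ u x (α v) (α y)
      - hm₁ u y (α v) (α x)
      + hm₁ v u (α x) (α y)
      - hm₁ v x (α u) (α y)
      + hm₁ v y (α u) (α x)
      + hm₁ x y (α u) (α v)
      - hm₁ y x (α u) (α v)
      - hm₂ (α u) v x (α y)
      + hm₂ (α u) v y (α x)
      - hm₂ (α u) x v (α y)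
      + hm₂ (α u) y v (α x)
      + hm₂ (α v) u x (α y)
      - hm₂ (α v) u y (α x)
      + hm₂ (α v) x u (α y)
      - hm₂ (α v) y u (α x)
      - hl u v x (α (α y))
      + hl u v y (α (α x))
      + hl u x y (α (α v))
      + hl v u x (α (α y))
      - hl v u y (α (α x))
      - hl v x y (α (α u))
      - hr u x y (α (α v))
      + hr v x y (α (α u))
      + hr x u y (α (α v))
      - hr x v y (α (α u))
      - hr y u x (α (α v))
      + hr y v x (α (α u))

theorem map_hComm {K A : Type*} [Field K] [AddCommGroup A] [Module K A]
    (mul : A →ₗ[K] A →ₗ[K] A) (α : A →ₗ[K] A)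
    (mult : ∀ x y : A, α (mul x y) = mul (α x) (α y)) (x y : A) :
    α (hComm mul x y) = hComm mul (α x) (α y) := by
  simp only [hComm, map_sub, mult]

theorem map_hTriple {K A : Type*} [Field K] [AddCommGroup A] [Module K A]
    (mul : A →ₗ[K] A →ₗ[K] A) (α : A →ₗ[K] A)
    (mult : ∀ x y : A, α (mul x y) = mul (α x) (α y)) (x y z : A) :
    α (hTriple mul α x y z) = hTriple mul α (α x) (α y) (α z) := by
  simp only [hTriple, hComm, hAssoc, map_sub, map_nsmul, LinearMap.sub_apply, mult]

/-- The operators `hTriple x y` are twisted derivations of the ternary bracket. -/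
theorem hTriple_hTriple {K A : Type*} [Field K] [AddCommGroup A] [Module K A]
    (mul : A →ₗ[K] A →ₗ[K] A) (α : A →ₗ[K] A)
    (mult : ∀ x y : A, α (mul x y) = mul (α x) (α y))
    (altR : ∀ x y : A, hAssoc (fun a b => mul a b) α x y y = 0)
    (u v w x y : A) :
    hTriple mul α (α (α x)) (α (α y)) (hTriple mul α u v w)
      = hTriple mul α (hTriple mul α x y u) (α (α v)) (α (α w))
        + hTriple mul α (α (α u)) (hTriple mul α x y v) (α (α w))
        + hTriple mul α (α (α u)) (α (α v)) (hTriple mul α x y w) := by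
  have hd := hTriple_jord mul α mult altR
  have hα := map_hTriple mul α mult
  have hsub (a b c d : A) :
      hTriple mul α a b (c - d) = hTriple mul α a b c - hTriple mul α a b d := by
    simp only [hTriple, hComm, hAssoc, map_sub, LinearMap.sub_apply]
    module
  have hj (a b : A) : α (jord (fun a b => mul a b) a b) = jord (fun a b => mul a b) (α a) (α b) := by
    simp only [jord, map_add, mult]
  have hadd (a b c : A) : jord (fun a b => mul a b) (a + b) c
      = jord (fun a b => mul a b) a c + jord (fun a b => mul a b) b c := by
    simp only [jord, map_add, LinearMap.add_apply]
    abel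
  rw [hTriple_eq_jord mul α altR u v w, hsub, hd, hd, hd, hd]
  simp only [hTriple_eq_jord mul α altR (hTriple mul α x y u),
    hTriple_eq_jord mul α altR (α (α u)), hα, hj, hadd]
  abel

theorem stmt14 {K A : Type*} [Field K] [CharZero K] [AddCommGroup A] [Module K A]
    (mul : A →ₗ[K] A →ₗ[K] A) (α : A →ₗ[K] A)
    (mult : ∀ x y : A, α (mul x y) = mul (α x) (α y))
    (altR : ∀ x y : A, hAssoc (fun a b => mul a b) α x y y = 0)
    (b : A → A → A) (hb : ∀ x y : A, b x y = mul x y - mul y x)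
    (T : A → A → A → A)
    (hT : ∀ x y z : A, T x y z = b (b x y) (α z) - 2 • hAssoc (fun a b => mul a b) α z x y) :
    (∀ x y : A, α (b x y) = b (α x) (α y))
    ∧ (∀ x y z : A, α (T x y z) = T (α x) (α y) (α z))
    ∧ (∀ x y : A, b x y = - b y x)
    ∧ (∀ x y z : A, T x y z = - T y x z)
    ∧ (∀ x y z : A, T x y z + T y z x + T z x y = 0)
    ∧ (∀ u v x y : A, T (α x) (α y) (b u v)
        = b (T x y u) (α (α v)) + b (α (α u)) (T x y v)
          + T (α u) (α v) (b x y)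
          - b (b (α u) (α v)) (b (α x) (α y)))
    ∧ (∀ u v w x y : A, T (α (α x)) (α (α y)) (T u v w)
        = T (T x y u) (α (α v)) (α (α w))
          + T (α (α u)) (T x y v) (α (α w))
          + T (α (α u)) (α (α v)) (T x y w)) := by
  obtain rfl : b = hComm mul := funext₂ hb
  obtain rfl : T = hTriple mul α := funext₃ hT
  have hj := hTriple_eq_jord mul α altR
  refine ⟨map_hComm mul α mult, map_hTriple mul α mult, fun x y => (neg_sub _ _).symm,
    fun x y z => ?_, fun x y z => ?_, hTriple_hComm mul α mult altR,
    hTriple_hTriple mul α mult altR⟩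
  · rw [hj, hj, neg_sub]
  · simp only [hj, jord, map_add, LinearMap.add_apply]
    abel
end
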